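/- Let ν > 1/2 and x, t, s ∈ ℝ, and define Q_n(u) = (u^n/n!) · e^{ux} · ₀F₁(-; ν + 1/2 + n; (x² - 1)u²/4) for n ∈ ℕ. Then the series below converges absolutely and the addition formula for ultraspherical-polynomial moments holds: Q_0(t+s) = Σ_{n=0}^∞ [(n + ν - 1/2)(-1)^n (2ν-1)_n / ((ν+1/2)_n (ν-1/2)_{n+1})] · ((1-x²)^n n!/4^n) · Q_n(t) · Q_n(s). -/

import Mathlib

/-- The Pochhammer symbol `(a)_n = a(a+1)⋯(a+n-1)`. -/
noncomputable def poch (a : ℝ) (n : ℕ) : ℝ := ∏ i ∈ Finset.range n, (a + i)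

/-- The hypergeometric function `₀F₁(-; c; z)`. -/
noncomputable def zeroF1 (c z : ℝ) : ℝ := ∑' n : ℕ, z ^ n / (poch c n * n.factorial)

/-- `Q_n(u) = (u^n/n!) e^{ux} ₀F₁(-; ν+1/2+n; (x²-1)u²/4)`, the functions
attached to the ultraspherical polynomials viewed as moments. -/
noncomputable def QUltra (ν x u : ℝ) (n : ℕ) : ℝ :=
  u ^ n / n.factorial * Real.exp (u * x) *
    zeroF1 (ν + 1 / 2 + n) ((x ^ 2 - 1) * u ^ 2 / 4)

theorem poch_zero' (a : ℝ) : poch a 0 = 1 := by simp [poch]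

theorem poch_succ' (a : ℝ) (n : ℕ) : poch a (n + 1) = poch a n * (a + n) := by
  simp [poch, Finset.prod_range_succ]

theorem poch_succ_left' (a : ℝ) (n : ℕ) : poch a (n + 1) = a * poch (a + 1) n := by
  simp only [poch, Finset.prod_range_succ']
  rw [mul_comm]
  congr 1
  · simp
  · apply Finset.prod_congr rfl
    intro i _
    push_cast
    ring

theorem poch_pos' {a : ℝ} (ha : 0 < a) (n : ℕ) : 0 < poch a n :=
  Finset.prod_pos fun i _ => by positivity

theorem one_le_poch {a : ℝ} (ha : 1 ≤ a) (n : ℕ) : 1 ≤ poch a n := by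
  induction n with
  | zero => simp [poch]
  | succ n ih =>
    rw [poch_succ']
    have : (0 : ℝ) ≤ n := by positivity
    nlinarith

theorem zf_term_bound {c : ℝ} (hc : 1 ≤ c) (z : ℝ) (n : ℕ) :
    ‖z ^ n / (poch c n * n.factorial)‖ ≤ |z| ^ n / n.factorial := by
  rw [Real.norm_eq_abs, abs_div, abs_pow, abs_mul]
  have h1 := one_le_poch hc n
  have h2 : (0 : ℝ) < n.factorial := by positivity
  rw [abs_of_pos (show 0 < poch c n by linarith), abs_of_pos h2]
  apply div_le_div_of_nonneg_left (by positivity) h2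
  nlinarith

theorem zf_summable {c : ℝ} (hc : 1 ≤ c) (z : ℝ) :
    Summable (fun n : ℕ => z ^ n / (poch c n * n.factorial)) :=
  Summable.of_norm_bounded (Real.summable_pow_div_factorial |z|) (zf_term_bound hc z)

theorem zf_bound {c : ℝ} (hc : 1 ≤ c) (z : ℝ) : |zeroF1 c z| ≤ Real.exp |z| := by
  rw [Real.exp_eq_exp_ℝ, NormedSpace.exp_eq_tsum_div, ← Real.norm_eq_abs]
  exact tsum_of_norm_bounded (Real.summable_pow_div_factorial |z|).hasSum (zf_term_bound hc z)

theorem zf_zero (c : ℝ) : zeroF1 c 0 = 1 := by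
  unfold zeroF1
  rw [tsum_eq_single 0]
  · simp [poch]
  · intro n hn
    simp [hn]

theorem zf_contig {c : ℝ} (hc : 1 ≤ c) (z : ℝ) :
    zeroF1 c z = zeroF1 (c + 1) z + z / (c * (c + 1)) * zeroF1 (c + 2) z := by
  unfold zeroF1
  rw [(zf_summable hc z).tsum_eq_zero_add,
    (zf_summable (show 1 ≤ c + 1 by linarith) z).tsum_eq_zero_add, ← tsum_mul_left, add_assoc,
    ← Summable.tsum_add]
  · simp only [poch_zero', pow_zero]
    congr 1
    apply tsum_congr
    intro m
    have e1 : poch c (m + 1) = c * poch (c + 1) m := poch_succ_left' c m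
    have e2 : poch (c + 1) (m + 1) = poch (c + 1) m * (c + 1 + m) := poch_succ' _ m
    have e3 : poch (c + 1) (m + 1) = (c + 1) * poch (c + 2) m := by
      rw [poch_succ_left']; congr 2; ring
    have p1 := poch_pos' (show 0 < c + 1 by linarith) m
    have p2 := poch_pos' (show 0 < c + 2 by linarith) m
    have hm : (0 : ℝ) < m.factorial := by positivity
    have h0 : 0 < c := by linarith
    have h1 : 0 < c + 1 := by linarith
    have h2 : 0 < c + 1 + m := by positivity
    have e4 : poch (c + 2) m = poch (c + 1) m * (c + 1 + m) / (c + 1) := by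
      field_simp; linarith
    rw [e1, e2, e4, Nat.factorial_succ]
    push_cast
    field_simp
    ring
  · exact (summable_nat_add_iff 1).2 (zf_summable (show 1 ≤ c + 1 by linarith) z)
  · exact (zf_summable (show 1 ≤ c + 2 by linarith) z).mul_left _

theorem zf_deriv {c : ℝ} (hc : 1 ≤ c) (z : ℝ) :
    HasDerivAt (zeroF1 c) (zeroF1 (c + 1) z / c) z := by
  set R := |z| + 1 with hR
  have hsum : Summable (fun n : ℕ => (n : ℝ) * R ^ (n - 1) / n.factorial) := by
    rw [← summable_nat_add_iff 1]
    refine (Real.summable_pow_div_factorial R).congr ?_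
    intro n
    rw [Nat.factorial_succ]
    push_cast
    try simp only [Nat.add_sub_cancel]
    field_simp
  have hz : z ∈ Metric.ball (0 : ℝ) R := by simp [hR]
  have key := hasDerivAt_tsum_of_isPreconnected (𝕜 := ℝ)
    (g := fun (n : ℕ) (y : ℝ) => y ^ n / (poch c n * n.factorial))
    (g' := fun (n : ℕ) (y : ℝ) => (n : ℝ) * y ^ (n - 1) / (poch c n * n.factorial))
    hsum (t := Metric.ball (0 : ℝ) R) (y₀ := z) (y := z) Metric.isOpen_ball
    (convex_ball (0 : ℝ) R).isPreconnected
    (fun n y _ => (hasDerivAt_pow n y).div_const _) ?_ hz (zf_summable hc z) hz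
  · refine HasDerivAt.congr_deriv key (Eq.symm ?_)
    have hs : Summable (fun n : ℕ => (n : ℝ) * z ^ (n - 1) / (poch c n * n.factorial)) := by
      rw [← summable_nat_add_iff 1]
      refine ((zf_summable (show 1 ≤ c + 1 by linarith) z).div_const c).congr ?_
      intro n
      have p1 := poch_pos' (show 0 < c + 1 by linarith) n
      rw [Nat.factorial_succ, poch_succ_left']
      push_cast
      try simp only [Nat.add_sub_cancel]
      field_simp
    rw [hs.tsum_eq_zero_add]
    unfold zeroF1
    rw [← tsum_div_const]
    simp only [Nat.cast_zero, zero_mul, zero_div, zero_add]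
    apply tsum_congr
    intro n
    have p1 := poch_pos' (show 0 < c + 1 by linarith) n
    rw [Nat.factorial_succ, poch_succ_left']
    push_cast
    try simp only [Nat.add_sub_cancel]
    field_simp
  · intro n y hy
    have hy' : |y| ≤ R := by
      have := Metric.mem_ball.1 hy
      simp at this
      exact this.le
    have h1 := one_le_poch hc n
    have h2 : (0 : ℝ) < n.factorial := by positivity
    rw [Real.norm_eq_abs, abs_div, abs_mul, abs_mul, abs_pow, abs_of_pos h2, Nat.abs_cast,
      abs_of_pos (show 0 < poch c n by linarith)]
    apply div_le_div₀ (by positivity) _ h2 (by nlinarith)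
    gcongr

/-- `u_n(p) = p^n F_{c+n}(w p²)` with `c = μ + 1`. -/
noncomputable def uu (μ w : ℝ) (n : ℕ) (p : ℝ) : ℝ := p ^ n * zeroF1 (μ + 1 + n) (w * p ^ 2)

noncomputable def AA (μ : ℝ) (n : ℕ) : ℝ :=
  poch (2 * μ) n / (poch (μ + 1) n * poch μ n * n.factorial)

theorem AA_succ {μ : ℝ} (hμ : 0 < μ) (n : ℕ) :
    ((n : ℝ) + 1) * AA μ (n + 1) = AA μ n * ((2 * μ + n) / ((μ + n) * (μ + n + 1))) := by
  unfold AA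
  have p1 := poch_pos' (show 0 < μ + 1 by linarith) n
  have p2 := poch_pos' hμ n
  have h1 : 0 < μ + n := by positivity
  have h2 : 0 < μ + n + 1 := by positivity
  have h3 : μ + 1 + n = μ + n + 1 := by ring
  rw [poch_succ', poch_succ', poch_succ', Nat.factorial_succ, h3]
  push_cast
  field_simp

theorem AA_nonneg {μ : ℝ} (hμ : 0 < μ) (n : ℕ) : 0 ≤ AA μ n := by
  have p1 := poch_pos' (show 0 < μ + 1 by linarith) n
  have p2 := poch_pos' hμ n
  have p3 := poch_pos' (show 0 < 2 * μ by linarith) n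
  unfold AA
  positivity

theorem AA_le {μ : ℝ} (hμ : 0 < μ) (n : ℕ) : AA μ n ≤ 2 ^ n / n.factorial := by
  induction n with
  | zero => simp [AA, poch]
  | succ n ih =>
    have h := AA_succ hμ n
    have h1 : (2 * μ + n) / ((μ + n) * (μ + n + 1)) ≤ 2 := by
      have hn : (0 : ℝ) ≤ n := by positivity
      rw [div_le_iff₀ (by positivity)]
      nlinarith [mul_nonneg hμ.le hn]
    have h2 : ((n : ℝ) + 1) * AA μ (n + 1) ≤ 2 ^ n / n.factorial * 2 := by
      rw [h]
      apply mul_le_mul ih h1 _ (by positivity)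
      positivity
    rw [Nat.factorial_succ, le_div_iff₀ (by positivity)]
    rw [div_mul_eq_mul_div, le_div_iff₀ (by positivity)] at h2
    push_cast
    rw [pow_succ]
    linarith

theorem uu_bound {μ : ℝ} (hμ : 0 < μ) (w : ℝ) (n : ℕ) {p R : ℝ} (hp : |p| ≤ R) :
    |uu μ w n p| ≤ R ^ n * Real.exp (|w| * R ^ 2) := by
  unfold uu
  rw [abs_mul, abs_pow]
  have hc : 1 ≤ μ + 1 + n := by
    have : (0 : ℝ) ≤ n := by positivity
    linarith
  have h0 : 0 ≤ R := (abs_nonneg p).trans hp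
  apply mul_le_mul (pow_le_pow_left₀ (abs_nonneg p) hp n) _ (abs_nonneg _) (by positivity)
  refine (zf_bound hc _).trans (Real.exp_le_exp.2 ?_)
  rw [abs_mul, abs_pow]
  gcongr

theorem uu_deriv {μ : ℝ} (hμ : 0 < μ) (w : ℝ) (n : ℕ) (p : ℝ) :
    HasDerivAt (uu μ w n) (n * uu μ w (n - 1) p +
      w * ((2 * μ + n) / ((μ + n) * (μ + n + 1))) * uu μ w (n + 1) p) p := by
  have hn0 : (0 : ℝ) ≤ n := by positivity
  have hc : 1 ≤ μ + 1 + n := by linarith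
  have h1 : HasDerivAt (fun p : ℝ => w * p ^ 2) (w * (2 * p)) p := by
    simpa using (hasDerivAt_pow 2 p).const_mul w
  have h2 := (hasDerivAt_pow n p).mul ((zf_deriv hc (w * p ^ 2)).comp p h1)
  refine HasDerivAt.congr_deriv h2 (Eq.symm ?_)
  unfold uu
  have e1 : μ + 1 + ((n + 1 : ℕ) : ℝ) = μ + 1 + n + 1 := by push_cast; ring
  rw [e1]
  simp only [Function.comp]
  have q1 : 0 < μ + n := by linarith
  have q2 : 0 < μ + n + 1 := by linarith
  have q3 : μ + 1 + n = μ + n + 1 := by ring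
  rcases n with _ | m
  · simp only [Nat.cast_zero, add_zero, zero_mul, zero_add, pow_zero, pow_one] at *
    field_simp
  · have hm0 : (0 : ℝ) ≤ m := by positivity
    have hk := zf_contig (show 1 ≤ μ + 1 + m by linarith) (w * p ^ 2)
    simp only [Nat.add_sub_cancel]
    rw [hk]
    push_cast at *
    have e2 : μ + 1 + (m : ℝ) + 1 = μ + 1 + (m + 1) := by ring
    have e3 : μ + 1 + (m : ℝ) + 2 = μ + 1 + (m + 1) + 1 := by ring
    rw [e2, e3]
    generalize zeroF1 (μ + 1 + (m + 1)) (w * p ^ 2) = F1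
    generalize zeroF1 (μ + 1 + (m + 1) + 1) (w * p ^ 2) = F2
    have r1 : μ + 1 + (m : ℝ) ≠ 0 := by linarith
    have r2 : μ + 1 + ((m : ℝ) + 1) ≠ 0 := by linarith
    have r3 : μ + ((m : ℝ) + 1) = μ + 1 + m := by ring
    have r4 : μ + 1 + (m : ℝ) + 1 = μ + 1 + (m + 1) := by ring
    rw [r3, r4]
    field_simp
    ring

theorem phi_deriv {μ : ℝ} (hμ : 0 < μ) (w r : ℝ) (M : ℕ) (p : ℝ) :
    HasDerivAt (fun p => ∑ n ∈ Finset.range (M + 1),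
        AA μ n * w ^ n * (uu μ w n p * uu μ w n (r - p)))
      (((M : ℝ) + 1) * AA μ (M + 1) * w ^ (M + 1) *
        (uu μ w (M + 1) p * uu μ w M (r - p) - uu μ w M p * uu μ w (M + 1) (r - p))) p := by
  have hrp : HasDerivAt (fun p : ℝ => r - p) (-1) p := by
    simpa using (hasDerivAt_id p).const_sub r
  have hterm : ∀ n : ℕ, HasDerivAt (fun p => AA μ n * w ^ n * (uu μ w n p * uu μ w n (r - p)))
      _ p := fun n =>
    ((uu_deriv hμ w n p).mul ((uu_deriv hμ w n (r - p)).comp p hrp)).const_mul (AA μ n * w ^ n)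
  induction M with
  | zero =>
    have h := hterm 0
    have hA := AA_succ hμ 0
    simp only [zero_add, Finset.sum_range_one]
    refine HasDerivAt.congr_deriv h (Eq.symm ?_)
    rw [hA]
    simp only [Function.comp, zero_add, Nat.cast_zero]
    ring
  | succ M ih =>
    have h := ih.add (hterm (M + 1))
    have hA := AA_succ hμ (M + 1)
    have hfun : (fun p => ∑ n ∈ Finset.range (M + 1 + 1),
        AA μ n * w ^ n * (uu μ w n p * uu μ w n (r - p))) =
        (fun p => ∑ n ∈ Finset.range (M + 1),
        AA μ n * w ^ n * (uu μ w n p * uu μ w n (r - p))) + (fun p => AA μ (M + 1) * w ^ (M + 1) *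
          (uu μ w (M + 1) p * uu μ w (M + 1) (r - p))) := by
      funext p
      rw [Finset.sum_range_succ]
      rfl
    rw [hfun]
    refine HasDerivAt.congr_deriv h (Eq.symm ?_)
    rw [hA]
    simp only [Function.comp, Nat.add_sub_cancel]
    push_cast
    ring

theorem core_summable {μ : ℝ} (hμ : 0 < μ) (w t s : ℝ) :
    Summable (fun n : ℕ => |AA μ n * w ^ n * (uu μ w n t * uu μ w n s)|) := by
  set K := 2 * |w| * |t| * |s|
  refine Summable.of_nonneg_of_le (fun n => abs_nonneg _) (fun n => ?_)
    ((Real.summable_pow_div_factorial K).mul_left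
      (Real.exp (|w| * |t| ^ 2) * Real.exp (|w| * |s| ^ 2)))
  rw [abs_mul, abs_mul, abs_mul, abs_pow, abs_of_nonneg (AA_nonneg hμ n)]
  calc _ ≤ 2 ^ n / n.factorial * |w| ^ n * ((|t| ^ n * Real.exp (|w| * |t| ^ 2)) *
        (|s| ^ n * Real.exp (|w| * |s| ^ 2))) := by
        have a1 := AA_le hμ n
        have a2 := uu_bound hμ w n (le_refl |t|)
        have a3 := uu_bound hμ w n (le_refl |s|)
        gcongr
    _ = _ := by
        simp only [K, mul_pow]
        ring

theorem core_tendsto {μ : ℝ} (hμ : 0 < μ) (w t s : ℝ) :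
    Filter.Tendsto (fun M : ℕ => ∑ n ∈ Finset.range (M + 1),
        AA μ n * w ^ n * (uu μ w n t * uu μ w n s)) Filter.atTop
      (nhds (uu μ w 0 (t + s))) := by
  set R := |t + s| + |t| with hR
  set E := Real.exp (|w| * R ^ 2) with hE
  set K := 2 * |w| * R ^ 2 with hK
  have hR0 : 0 ≤ R := by positivity
  have hbound : ∀ M : ℕ, ‖(∑ n ∈ Finset.range (M + 1),
        AA μ n * w ^ n * (uu μ w n t * uu μ w n s)) - uu μ w 0 (t + s)‖ ≤
        4 * |w| * R * E ^ 2 * |t| * (K ^ M / M.factorial) := by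
    intro M
    have hmv := Convex.norm_image_sub_le_of_norm_hasDerivWithin_le (𝕜 := ℝ)
      (C := 4 * |w| * R * E ^ 2 * (K ^ M / M.factorial))
      (s := Set.Icc (-|t|) |t|) (x := 0) (y := t)
      (fun p _ => (phi_deriv hμ w (t + s) M p).hasDerivWithinAt) ?_ (convex_Icc _ _)
      (by simp) ⟨neg_abs_le t, le_abs_self t⟩
    · have e1 : t + s - t = s := by ring
      have e2 : (∑ n ∈ Finset.range (M + 1),
          AA μ n * w ^ n * (uu μ w n 0 * uu μ w n (t + s - 0))) = uu μ w 0 (t + s) := by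
        rw [Finset.sum_eq_single 0]
        · simp [AA, uu, poch, zf_zero]
        · intro n _ hn
          simp [uu, hn]
        · simp
      simp only [e1, e2] at hmv
      refine hmv.trans (le_of_eq ?_)
      rw [sub_zero, Real.norm_eq_abs]
      ring
    · intro p hp
      have hp1 : |p| ≤ |t| := abs_le.2 hp
      have hpR : |p| ≤ R := by
        have := abs_nonneg (t + s)
        linarith
      have hqR : |t + s - p| ≤ R := (abs_sub _ _).trans (by linarith)
      have b1 := uu_bound hμ w (M + 1) hpR
      have b2 := uu_bound hμ w M hpR
      have b3 := uu_bound hμ w (M + 1) hqR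
      have b4 := uu_bound hμ w M hqR
      rw [← hE] at b1 b2 b3 b4
      have hA : ((M : ℝ) + 1) * AA μ (M + 1) ≤ 2 ^ (M + 1) / M.factorial := by
        have := AA_le hμ (M + 1)
        rw [Nat.factorial_succ] at this
        push_cast at this
        calc _ ≤ ((M : ℝ) + 1) * (2 ^ (M + 1) / ((M + 1) * M.factorial)) := by gcongr
          _ = _ := by field_simp
      have hA0 : 0 ≤ ((M : ℝ) + 1) * AA μ (M + 1) := by
        have := AA_nonneg hμ (M + 1)
        positivity
      rw [Real.norm_eq_abs, abs_mul, abs_mul, abs_of_nonneg hA0, abs_pow]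
      have hd : |uu μ w (M + 1) p * uu μ w M (t + s - p) -
          uu μ w M p * uu μ w (M + 1) (t + s - p)| ≤
          (R ^ (M + 1) * E) * (R ^ M * E) + (R ^ M * E) * (R ^ (M + 1) * E) := by
        refine (abs_sub _ _).trans ?_
        rw [abs_mul, abs_mul]
        gcongr
      calc _ ≤ 2 ^ (M + 1) / M.factorial * |w| ^ (M + 1) *
            ((R ^ (M + 1) * E) * (R ^ M * E) + (R ^ M * E) * (R ^ (M + 1) * E)) := by
            gcongr
        _ = _ := by
            simp only [hK, mul_pow]
            ring
  rw [tendsto_iff_norm_sub_tendsto_zero]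
  refine squeeze_zero (fun _ => norm_nonneg _) hbound ?_
  simpa using (FloorSemiring.tendsto_pow_div_factorial_atTop K).const_mul
    (4 * |w| * R * E ^ 2 * |t|)

theorem core_hasSum {μ : ℝ} (hμ : 0 < μ) (w t s : ℝ) :
    HasSum (fun n : ℕ => AA μ n * w ^ n * (uu μ w n t * uu μ w n s)) (uu μ w 0 (t + s)) := by
  have h := (core_summable hμ w t s).of_abs
  have h1 := (Filter.tendsto_add_atTop_iff_nat 1).2 h.hasSum.tendsto_sum_nat
  have h2 := tendsto_nhds_unique h1 (core_tendsto hμ w t s)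
  rw [← h2]
  exact h.hasSum

theorem term_eq {ν : ℝ} (hν : 1 / 2 < ν) (x t s : ℝ) (n : ℕ) :
    ((n : ℝ) + ν - 1 / 2) * (-1) ^ n * poch (2 * ν - 1) n /
          (poch (ν + 1 / 2) n * poch (ν - 1 / 2) (n + 1)) *
          ((1 - x ^ 2) ^ n * n.factorial / 4 ^ n) *
        QUltra ν x t n * QUltra ν x s n =
    Real.exp ((t + s) * x) * (AA (ν - 1 / 2) n * ((x ^ 2 - 1) / 4) ^ n *
      (uu (ν - 1 / 2) ((x ^ 2 - 1) / 4) n t * uu (ν - 1 / 2) ((x ^ 2 - 1) / 4) n s)) := by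
  unfold QUltra AA uu
  have e1 : ν - 1 / 2 + 1 = ν + 1 / 2 := by ring
  have e2 : 2 * (ν - 1 / 2) = 2 * ν - 1 := by ring
  have e3 : ∀ p : ℝ, (x ^ 2 - 1) / 4 * p ^ 2 = (x ^ 2 - 1) * p ^ 2 / 4 := fun p => by ring
  have e4 : (x ^ 2 - 1) ^ n = (-1) ^ n * (1 - x ^ 2) ^ n := by
    rw [← mul_pow]; congr 1; ring
  rw [e1, e2, e3, e3, poch_succ', add_mul, Real.exp_add, div_pow, e4]
  have p1 := poch_pos' (show 0 < ν + 1 / 2 by linarith) n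
  have p2 := poch_pos' (show 0 < ν - 1 / 2 by linarith) n
  have h0 : (0 : ℝ) ≤ n := by positivity
  have h1 : (n : ℝ) + ν - 1 / 2 ≠ 0 := by linarith
  have h2 : ν - 1 / 2 + (n : ℝ) = n + ν - 1 / 2 := by ring
  rw [h2]
  generalize zeroF1 (ν + 1 / 2 + n) ((x ^ 2 - 1) * t ^ 2 / 4) = F1
  generalize zeroF1 (ν + 1 / 2 + n) ((x ^ 2 - 1) * s ^ 2 / 4) = F2
  generalize (n : ℝ) + ν - 1 / 2 = a at *
  generalize poch (ν + 1 / 2) n = P1 at *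
  generalize poch (ν - 1 / 2) n = P2 at *
  have hf : (n.factorial : ℝ) ≠ 0 := by positivity
  field_simp

/-- Addition formula for the ultraspherical-polynomial moment functions. -/
theorem ultraspherical_moment_addition (ν : ℝ) (hν : 1 / 2 < ν) (x t s : ℝ) :
    Summable (fun n : ℕ =>
      |((n : ℝ) + ν - 1 / 2) * (-1) ^ n * poch (2 * ν - 1) n /
          (poch (ν + 1 / 2) n * poch (ν - 1 / 2) (n + 1)) *
          ((1 - x ^ 2) ^ n * n.factorial / 4 ^ n) *
        QUltra ν x t n * QUltra ν x s n|) ∧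
    QUltra ν x (t + s) 0 =
      ∑' n : ℕ, ((n : ℝ) + ν - 1 / 2) * (-1) ^ n * poch (2 * ν - 1) n /
          (poch (ν + 1 / 2) n * poch (ν - 1 / 2) (n + 1)) *
          ((1 - x ^ 2) ^ n * n.factorial / 4 ^ n) *
        QUltra ν x t n * QUltra ν x s n := by
  have hμ : 0 < ν - 1 / 2 := by linarith
  have hsum := core_hasSum hμ ((x ^ 2 - 1) / 4) t s
  have habs := core_summable hμ ((x ^ 2 - 1) / 4) t s
  simp only [term_eq hν x t s]
  constructor
  · simp only [abs_mul (Real.exp ((t + s) * x))]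
    exact habs.mul_left _
  · rw [tsum_mul_left, hsum.tsum_eq]
    unfold QUltra uu
    have e1 : ν - 1 / 2 + 1 = ν + 1 / 2 := by ring
    have e3 : (x ^ 2 - 1) / 4 * (t + s) ^ 2 = (x ^ 2 - 1) * (t + s) ^ 2 / 4 := by ring
    rw [e1, e3]
    simp
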